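/- The Turán inequalities hold for the moments b_m: for every m ≥ 1, (b_m)² > ((2m−1)/(2m+1))·b_{m−1}·b_{m+1}. -/

import Mathlib

/-- The kernel `Φ(t) = Σ_{k=1}^∞ (2k⁴π²e^{9t} − 3k²πe^{5t})·exp(−k²πe^{4t})`. -/
noncomputable def Phi (t : ℝ) : ℝ :=
  ∑' k : ℕ, (2 * ((k : ℝ) + 1) ^ 4 * Real.pi ^ 2 * Real.exp (9 * t)
      - 3 * ((k : ℝ) + 1) ^ 2 * Real.pi * Real.exp (5 * t)) *
    Real.exp (-(((k : ℝ) + 1) ^ 2) * Real.pi * Real.exp (4 * t))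

/-- The `m`-th Turán moment `b m = ∫_0^∞ t^{2m}·Φ(t) dt`. -/
noncomputable def turanMoment (m : ℕ) : ℝ :=
  ∫ t in Set.Ioi (0 : ℝ), t ^ (2 * m) * Phi t

open Real Set MeasureTheory Filter Topology

/-- The term `n^(2l) (n² - a)^j exp(-(n² - a) y)`, with `n = k + s`. -/
noncomputable def thetaTerm (s : ℕ) (a : ℝ) (l j : ℕ) (k : ℕ) (y : ℝ) : ℝ :=
  (((k : ℝ) + s) ^ 2) ^ l * (((k : ℝ) + s) ^ 2 - a) ^ j * exp (-((((k : ℝ) + s) ^ 2 - a) * y))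

/-- The Gaussian-type series `Σ_{n ≥ s} n^(2l) (n² - a)^j exp(-(n² - a) y)`. -/
noncomputable def thetaSum (s : ℕ) (a : ℝ) (l j : ℕ) (y : ℝ) : ℝ :=
  ∑' k : ℕ, thetaTerm s a l j k y

lemma sq_add_sub_nonneg {s : ℕ} {a : ℝ} (has : a ≤ (s : ℝ) ^ 2) (k : ℕ) :
    0 ≤ ((k : ℝ) + s) ^ 2 - a := by
  have : (0 : ℝ) ≤ k := k.cast_nonneg
  have : (0 : ℝ) ≤ s := s.cast_nonneg
  nlinarith [mul_nonneg ‹(0 : ℝ) ≤ k› this]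

lemma thetaTerm_nonneg {s : ℕ} {a : ℝ} (has : a ≤ (s : ℝ) ^ 2) (l j k : ℕ) (y : ℝ) :
    0 ≤ thetaTerm s a l j k y := by
  have := sq_add_sub_nonneg has k
  unfold thetaTerm
  positivity

lemma thetaTerm_le_of_le {s : ℕ} {a : ℝ} (has : a ≤ (s : ℝ) ^ 2) (l j k : ℕ) {x y : ℝ}
    (hxy : x ≤ y) : thetaTerm s a l j k y ≤ thetaTerm s a l j k x := by
  have := sq_add_sub_nonneg has k
  unfold thetaTerm
  gcongr

lemma summable_thetaTerm {s : ℕ} {a : ℝ} (ha : 0 ≤ a) (has : a ≤ (s : ℝ) ^ 2) (l j : ℕ) {y : ℝ}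
    (hy : 0 < y) : Summable fun k => thetaTerm s a l j k y := by
  have h := ((summable_nat_add_iff s).2
    (Real.summable_pow_mul_exp_neg_nat_mul (2 * (l + j)) hy)).mul_right (exp (a * y))
  refine Summable.of_nonneg_of_le (fun k => thetaTerm_nonneg has l j k y) (fun k => ?_) h
  have h0 := sq_add_sub_nonneg has k
  have h1 : (((k + s : ℕ) : ℝ)) ≤ ((k : ℝ) + s) ^ 2 := by
    exact_mod_cast Nat.le_self_pow two_ne_zero (k + s)
  unfold thetaTerm
  calc (((k : ℝ) + s) ^ 2) ^ l * (((k : ℝ) + s) ^ 2 - a) ^ j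
        * exp (-((((k : ℝ) + s) ^ 2 - a) * y))
      ≤ (((k : ℝ) + s) ^ 2) ^ l * (((k : ℝ) + s) ^ 2) ^ j
        * exp (-y * ((k + s : ℕ) : ℝ) + a * y) := by
        gcongr
        · linarith
        · nlinarith
    _ = _ := by
        rw [exp_add, ← pow_add, ← pow_mul]
        push_cast
        ring

lemma hasDerivAt_thetaSum {s : ℕ} {a : ℝ} (ha : 0 ≤ a) (has : a ≤ (s : ℝ) ^ 2) (l j : ℕ) {y : ℝ}
    (hy : 0 < y) : HasDerivAt (thetaSum s a l j) (-thetaSum s a l (j + 1) y) y := by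
  have key := hasDerivAt_tsum_of_isPreconnected (𝕜 := ℝ)
    (g := fun k y => thetaTerm s a l j k y) (g' := fun k y => -thetaTerm s a l (j + 1) k y)
    (summable_thetaTerm ha has l (j + 1) (half_pos hy)) (isOpen_Ioi (a := y / 2))
    isPreconnected_Ioi (fun k x _ => ?_) (fun k x hx => ?_) (half_lt_self hy)
    (summable_thetaTerm ha has l j hy) (half_lt_self hy)
  · rw [tsum_neg] at key
    exact key
  · unfold thetaTerm
    have := ((((hasDerivAt_id x).const_mul (((k : ℝ) + s) ^ 2 - a)).neg.exp).const_mul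
      ((((k : ℝ) + s) ^ 2) ^ l * (((k : ℝ) + s) ^ 2 - a) ^ j))
    refine this.congr_deriv ?_
    simp only [id, mul_one, Pi.neg_apply]
    ring
  · rw [norm_neg, Real.norm_of_nonneg (thetaTerm_nonneg has _ _ _ _)]
    exact thetaTerm_le_of_le has _ _ _ (le_of_lt hx)

lemma thetaSum_eq_add {s : ℕ} {a : ℝ} (ha : 0 ≤ a) (has : a ≤ (s : ℝ) ^ 2) (l j : ℕ) {y : ℝ}
    (hy : 0 < y) : thetaSum s a l j y = thetaTerm s a l j 0 y + thetaSum (s + 1) a l j y := by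
  unfold thetaSum
  rw [(summable_thetaTerm ha has l j hy).tsum_eq_zero_add]
  congr 2
  ext k
  simp only [thetaTerm]
  push_cast
  ring_nf

/-- Differentiation rule for `y^n` times a Gaussian-type series under the Euler operator. -/
lemma hasDerivAt_pow_mul_thetaSum {s : ℕ} {a : ℝ} (ha : 0 ≤ a) (has : a ≤ (s : ℝ) ^ 2) (n l j : ℕ)
    {y : ℝ} (hy : 0 < y) :
    HasDerivAt (fun y => y ^ n * thetaSum s a l j y)
      ((n * (y ^ n * thetaSum s a l j y) - y ^ (n + 1) * thetaSum s a l (j + 1) y) / y) y := by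
  refine ((hasDerivAt_pow n y).mul (hasDerivAt_thetaSum ha has l j hy)).congr_deriv ?_
  rcases n with _ | n
  · simp only [CharP.cast_eq_zero, zero_mul, pow_zero, one_mul, zero_add, pow_one, zero_sub]
    field_simp
  · simp only [Nat.add_sub_cancel]
    field_simp
    ring

/-- The contribution of the terms `n ≥ 2` to the series `Σ n² (2 n² y - 3) exp(-(n² - 1) y)`
(for the index `0`), and its images under the powers of the Euler operator `y d/dy`. -/
noncomputable def kernelCorr : ℕ → ℝ → ℝ
  | 0, y => 2 * (y ^ 1 * thetaSum 2 1 2 0 y) - 3 * (y ^ 0 * thetaSum 2 1 1 0 y)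
  | 1, y => 2 * (y ^ 1 * thetaSum 2 1 2 0 y) - 2 * (y ^ 2 * thetaSum 2 1 2 1 y)
      + 3 * (y ^ 1 * thetaSum 2 1 1 1 y)
  | 2, y => 2 * (y ^ 1 * thetaSum 2 1 2 0 y) - 6 * (y ^ 2 * thetaSum 2 1 2 1 y)
      + 2 * (y ^ 3 * thetaSum 2 1 2 2 y) + 3 * (y ^ 1 * thetaSum 2 1 1 1 y)
      - 3 * (y ^ 2 * thetaSum 2 1 1 2 y)
  | 3, y => 2 * (y ^ 1 * thetaSum 2 1 2 0 y) - 14 * (y ^ 2 * thetaSum 2 1 2 1 y)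
      + 12 * (y ^ 3 * thetaSum 2 1 2 2 y) - 2 * (y ^ 4 * thetaSum 2 1 2 3 y)
      + 3 * (y ^ 1 * thetaSum 2 1 1 1 y) - 9 * (y ^ 2 * thetaSum 2 1 1 2 y)
      + 3 * (y ^ 3 * thetaSum 2 1 1 3 y)
  | _, y => 2 * (y ^ 1 * thetaSum 2 1 2 0 y) - 30 * (y ^ 2 * thetaSum 2 1 2 1 y)
      + 50 * (y ^ 3 * thetaSum 2 1 2 2 y) - 20 * (y ^ 4 * thetaSum 2 1 2 3 y)
      + 2 * (y ^ 5 * thetaSum 2 1 2 4 y) + 3 * (y ^ 1 * thetaSum 2 1 1 1 y)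
      - 21 * (y ^ 2 * thetaSum 2 1 1 2 y) + 18 * (y ^ 3 * thetaSum 2 1 1 3 y)
      - 3 * (y ^ 4 * thetaSum 2 1 1 4 y)

lemma hasDerivAt_kernelCorr {j : ℕ} (hj : j < 4) {y : ℝ} (hy : 0 < y) :
    HasDerivAt (kernelCorr j) (kernelCorr (j + 1) y / y) y := by
  have D (n l i : ℕ) := hasDerivAt_pow_mul_thetaSum (s := 2) zero_le_one (by norm_num) n l i hy
  interval_cases j
  · refine (((D 1 2 0).const_mul 2).sub ((D 0 1 0).const_mul 3)).congr_deriv ?_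
    simp only [kernelCorr]
    push_cast
    ring
  · refine ((((D 1 2 0).const_mul 2).sub ((D 2 2 1).const_mul 2)).add
      ((D 1 1 1).const_mul 3)).congr_deriv ?_
    simp only [kernelCorr]
    push_cast
    ring
  · refine ((((((D 1 2 0).const_mul 2).sub ((D 2 2 1).const_mul 6)).add
      ((D 3 2 2).const_mul 2)).add ((D 1 1 1).const_mul 3)).sub
      ((D 2 1 2).const_mul 3)).congr_deriv ?_
    simp only [kernelCorr]
    push_cast
    ring
  · refine ((((((((D 1 2 0).const_mul 2).sub ((D 2 2 1).const_mul 14)).add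
      ((D 3 2 2).const_mul 12)).sub ((D 4 2 3).const_mul 2)).add ((D 1 1 1).const_mul 3)).sub
      ((D 2 1 2).const_mul 9)).add ((D 3 1 3).const_mul 3)).congr_deriv ?_
    simp only [kernelCorr]
    push_cast
    ring

lemma add_three_pow_le {p : ℕ} (hp : p ≤ 6) (k : ℕ) :
    (((k : ℝ) + 3) ^ 2) ^ p ≤ 9 ^ p * 32 ^ k := by
  induction k with
  | zero => norm_num
  | succ k ih =>
    have h1 : ((((k + 1 : ℕ) : ℝ) + 3) ^ 2) ^ p ≤ (16 / 9) ^ p * (((k : ℝ) + 3) ^ 2) ^ p := by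
      rw [← mul_pow]
      have : (0 : ℝ) ≤ k := k.cast_nonneg
      gcongr
      push_cast
      nlinarith
    have h2 : (16 / 9 : ℝ) ^ p ≤ 32 :=
      (pow_le_pow_right₀ (by norm_num) hp).trans (by norm_num)
    calc _ ≤ _ := h1
      _ ≤ 32 * (9 ^ p * 32 ^ k) := by gcongr
      _ = _ := by ring

lemma exp_neg_five_mul_le {y : ℝ} (hy : 3.14 ≤ y) : exp (-(5 * y)) ≤ 1 / 10 ^ 6 := by
  have h1 : (10 : ℝ) ^ 6 ≤ exp (5 * y) := by
    calc (10 : ℝ) ^ 6 ≤ 2.7 ^ 15 := by norm_num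
      _ ≤ exp 1 ^ 15 := by
        have := exp_one_gt_d9
        gcongr
        linarith
      _ = exp 15 := by rw [← exp_nat_mul]; norm_num
      _ ≤ exp (5 * y) := by gcongr; linarith
  rw [exp_neg, ← one_div]
  exact one_div_le_one_div_of_le (by norm_num) h1

lemma thetaSum_three_le {l j : ℕ} (hlj : l + j ≤ 6) {y : ℝ} (hy : 3.14 ≤ y) :
    thetaSum 3 1 l j y ≤ 9 ^ (l + j) * (1.1 / 10 ^ 6) * exp (-(3 * y)) := by
  have hg : HasSum (fun k : ℕ => 9 ^ (l + j) * (1 / 10 ^ 6) * exp (-(3 * y))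
      * (32 / 10 ^ 6 : ℝ) ^ k)
      (9 ^ (l + j) * (1 / 10 ^ 6) * exp (-(3 * y)) * (1 - 32 / 10 ^ 6)⁻¹) :=
    (hasSum_geometric_of_lt_one (by norm_num) (by norm_num)).mul_left _
  have hle : thetaSum 3 1 l j y
      ≤ 9 ^ (l + j) * (1 / 10 ^ 6) * exp (-(3 * y)) * (1 - 32 / 10 ^ 6)⁻¹ := by
    rw [← hg.tsum_eq]
    refine (summable_thetaTerm zero_le_one (by norm_num) l j (by linarith)).tsum_le_tsum
      (fun k => ?_) hg.summable
    have hk : (0 : ℝ) ≤ k := k.cast_nonneg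
    have h1 : (((k : ℝ) + (3 : ℕ)) ^ 2) ^ l * (((k : ℝ) + (3 : ℕ)) ^ 2 - 1) ^ j
        ≤ 9 ^ (l + j) * 32 ^ k := by
      refine le_trans ?_ (add_three_pow_le hlj k)
      rw [pow_add]
      push_cast
      gcongr
      · nlinarith
      · linarith
    have h2 : exp (-((((k : ℝ) + (3 : ℕ)) ^ 2 - 1) * y))
        ≤ exp (-(3 * y)) * (1 / 10 ^ 6) ^ (k + 1) := by
      calc exp (-((((k : ℝ) + (3 : ℕ)) ^ 2 - 1) * y))
          ≤ exp (-(3 * y) + (k + 1 : ℕ) * (-(5 * y))) := by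
            gcongr
            push_cast
            nlinarith [mul_nonneg hk (by linarith : (0 : ℝ) ≤ y),
              mul_nonneg (mul_nonneg hk hk) (by linarith : (0 : ℝ) ≤ y)]
        _ = exp (-(3 * y)) * exp (-(5 * y)) ^ (k + 1) := by rw [exp_add, exp_nat_mul]
        _ ≤ _ := by
          gcongr
          exact exp_neg_five_mul_le hy
    calc thetaTerm 3 1 l j k y
        ≤ (9 ^ (l + j) * 32 ^ k) * (exp (-(3 * y)) * (1 / 10 ^ 6) ^ (k + 1)) := by
          unfold thetaTerm
          gcongr
      _ = _ := by
        rw [div_pow, div_pow, one_pow]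
        ring
  refine hle.trans ?_
  have : (0 : ℝ) < 9 ^ (l + j) * exp (-(3 * y)) := by positivity
  norm_num
  nlinarith

lemma thetaSum_two_bounds {l j : ℕ} (hl : l ≤ 2) (hj : j ≤ 4) {y : ℝ} (hy : 3.14 ≤ y) :
    4 ^ l * 3 ^ j * exp (-(3 * y)) ≤ thetaSum 2 1 l j y ∧
      thetaSum 2 1 l j y ≤ 1.001 * (4 ^ l * 3 ^ j * exp (-(3 * y))) := by
  have h0 : thetaTerm 2 1 l j 0 y = 4 ^ l * 3 ^ j * exp (-(3 * y)) := by
    unfold thetaTerm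
    norm_num
  have h1 : 0 ≤ thetaSum 3 1 l j y := tsum_nonneg fun k => thetaTerm_nonneg (by norm_num) _ _ _ _
  have h2 := thetaSum_three_le (l := l) (j := j) (by omega) hy
  have h3 : (9 : ℝ) ^ (l + j) * (1.1 / 10 ^ 6) ≤ 0.001 * (4 ^ l * 3 ^ j) := by
    interval_cases l <;> interval_cases j <;> norm_num
  have h4 := mul_le_mul_of_nonneg_right h3 (exp_pos (-(3 * y))).le
  rw [thetaSum_eq_add zero_le_one (by norm_num) l j (by linarith), h0]
  constructor <;> linarith

lemma le_exp_three_mul {x : ℝ} (hx : 0 ≤ x) :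
    12300 * (1 + 3 * x + 9 / 2 * x ^ 2 + 9 / 2 * x ^ 3 + 27 / 8 * x ^ 4 + 81 / 40 * x ^ 5
      + 81 / 80 * x ^ 6) ≤ exp (3 * (3.14 + x)) := by
  have h1 : (8100 : ℝ) ≤ exp 9 := by
    calc (8100 : ℝ) ≤ 2.7182818 ^ 9 := by norm_num
      _ ≤ exp 1 ^ 9 := by
        have := exp_one_gt_d9
        gcongr
        linarith
      _ = exp 9 := by rw [← exp_nat_mul]; norm_num
  have h2 := sum_le_exp_of_nonneg (x := 0.42) (by norm_num) 5
  have h3 := sum_le_exp_of_nonneg (x := 3 * x) (by linarith) 7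
  simp only [Finset.sum_range_succ, Finset.sum_range_zero, Nat.factorial] at h2 h3
  have h4 : (12300 : ℝ) ≤ exp 9 * exp 0.42 := by
    calc (12300 : ℝ) ≤ 8100 * 1.521 := by norm_num
      _ ≤ _ := by
        gcongr
        refine le_trans ?_ h2
        norm_num
  have h5 : exp (3 * (3.14 + x)) = exp 9 * exp 0.42 * exp (3 * x) := by
    rw [← exp_add, ← exp_add]
    ring_nf
  rw [h5]
  refine mul_le_mul h4 (le_trans (le_of_eq ?_) h3) (by positivity) (by positivity)
  push_cast
  ring

lemma kernelCorr_bounds {y : ℝ} (hy : 3.14 ≤ y) :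
    (0 ≤ kernelCorr 0 y ∧ kernelCorr 0 y ≤ 0.01) ∧
    (-0.07 ≤ kernelCorr 1 y ∧ kernelCorr 1 y ≤ 0.01) ∧
    (-0.01 ≤ kernelCorr 2 y ∧ kernelCorr 2 y ≤ 0.5) ∧
    (-2.5 ≤ kernelCorr 3 y ∧ kernelCorr 3 y ≤ 0.1) ∧
    (0 ≤ kernelCorr 4 y ∧ kernelCorr 4 y ≤ 10) := by
  have B {l j : ℕ} (hl : l ≤ 2) (hj : j ≤ 4) (n : ℕ) :
      y ^ n * (4 ^ l * 3 ^ j * exp (-(3 * y))) ≤ y ^ n * thetaSum 2 1 l j y ∧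
      y ^ n * thetaSum 2 1 l j y ≤ y ^ n * (1.001 * (4 ^ l * 3 ^ j * exp (-(3 * y)))) := by
    have h := thetaSum_two_bounds hl hj hy
    have hn : 0 ≤ y ^ n := pow_nonneg (by linarith) n
    exact ⟨mul_le_mul_of_nonneg_left h.1 hn, mul_le_mul_of_nonneg_left h.2 hn⟩
  obtain ⟨x, rfl⟩ : ∃ x, y = 3.14 + x := ⟨y - 3.14, by ring⟩
  have hx : 0 ≤ x := by linarith
  have hE := le_exp_three_mul hx
  set F := exp (-(3 * (3.14 + x))) with hF
  have hF0 : 0 < F := exp_pos _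
  have key {p c : ℝ} (hc : 0 ≤ c) (h : p ≤ c * (12300 * (1 + 3 * x + 9 / 2 * x ^ 2
      + 9 / 2 * x ^ 3 + 27 / 8 * x ^ 4 + 81 / 40 * x ^ 5 + 81 / 80 * x ^ 6))) : p * F ≤ c := by
    calc p * F ≤ c * exp (3 * (3.14 + x)) * F := by
          gcongr
          exact h.trans (by gcongr)
      _ = c := by rw [hF, exp_neg, mul_assoc, mul_inv_cancel₀ (exp_pos _).ne', mul_one]
  have B20 := B (l := 2) (j := 0) (by norm_num) (by norm_num) 1
  have B21 := B (l := 2) (j := 1) (by norm_num) (by norm_num) 2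
  have B22 := B (l := 2) (j := 2) (by norm_num) (by norm_num) 3
  have B23 := B (l := 2) (j := 3) (by norm_num) (by norm_num) 4
  have B24 := B (l := 2) (j := 4) (by norm_num) (by norm_num) 5
  have B10 := B (l := 1) (j := 0) (by norm_num) (by norm_num) 0
  have B11 := B (l := 1) (j := 1) (by norm_num) (by norm_num) 1
  have B12 := B (l := 1) (j := 2) (by norm_num) (by norm_num) 2
  have B13 := B (l := 1) (j := 3) (by norm_num) (by norm_num) 3
  have B14 := B (l := 1) (j := 4) (by norm_num) (by norm_num) 4
  clear_value F
  have x2 := pow_nonneg hx 2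
  have x3 := pow_nonneg hx 3
  have x4 := pow_nonneg hx 4
  have x5 := pow_nonneg hx 5
  have x6 := pow_nonneg hx 6
  simp only [kernelCorr]
  set y := 3.14 + x with hy'
  refine ⟨⟨?_, ?_⟩, ⟨?_, ?_⟩, ⟨?_, ?_⟩, ⟨?_, ?_⟩, ⟨?_, ?_⟩⟩
  · have := @key (12.012 - 32 * y) 0 le_rfl (by rw [hy']; linarith)
    linarith
  · have := @key (32.032 * y - 12) 0.01 (by norm_num) (by rw [hy']; linarith)
    linarith
  · have := @key (96.096 * y ^ 2 - 68 * y) 0.07 (by norm_num) (by rw [hy']; linarith)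
    linarith
  · have := @key (68.068 * y - 96 * y ^ 2) 0.01 (by norm_num) (by rw [hy']; linarith)
    linarith
  · have := @key (396.396 * y ^ 2 - 68 * y - 288 * y ^ 3) 0.01 (by norm_num)
      (by rw [hy']; linarith)
    linarith
  · have := @key (68.068 * y - 396 * y ^ 2 + 288.288 * y ^ 3) 0.5 (by norm_num)
      (by rw [hy']; linarith)
    linarith
  · have := @key (996.996 * y ^ 2 - 68 * y - 2052 * y ^ 3 + 864.864 * y ^ 4) 2.5 (by norm_num)
      (by rw [hy']; linarith)
    linarith
  · have := @key (68.068 * y - 996 * y ^ 2 + 2054.052 * y ^ 3 - 864 * y ^ 4) 0.1 (by norm_num)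
      (by rw [hy']; linarith)
    linarith
  · have := @key (2198.196 * y ^ 2 - 68 * y - 9144 * y ^ 3 + 9621.612 * y ^ 4 - 2592 * y ^ 5) 0
      le_rfl (by rw [hy']; linarith)
    linarith
  · have := @key (68.068 * y - 2196 * y ^ 2 + 9153.144 * y ^ 3 - 9612 * y ^ 4 + 2594.592 * y ^ 5)
      10 (by norm_num) (by rw [hy']; linarith)
    linarith

/-- The power series factor of the kernel and its images under the powers of `y d/dy`. -/
noncomputable def kernelFactor (j : ℕ) (y : ℝ) : ℝ :=
  (if j = 0 then 2 * y - 3 else 2 * y) + kernelCorr j y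

lemma hasDerivAt_kernelFactor {j : ℕ} (hj : j < 4) {y : ℝ} (hy : 0 < y) :
    HasDerivAt (kernelFactor j) (kernelFactor (j + 1) y / y) y := by
  have h2 : HasDerivAt (fun y : ℝ => 2 * y) 2 y := by
    simpa using (hasDerivAt_id y).const_mul (2 : ℝ)
  have h1 : HasDerivAt (fun y : ℝ => if j = 0 then 2 * y - 3 else 2 * y) 2 y := by
    split_ifs
    · exact h2.sub_const 3
    · exact h2
  refine (h1.add (hasDerivAt_kernelCorr hj hy)).congr_deriv ?_
  simp only [kernelFactor, Nat.add_eq_zero_iff, one_ne_zero, and_false, if_false]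
  field_simp

lemma kernelFactor_zero_ge {y : ℝ} (hy : 3.14 ≤ y) : 3 ≤ kernelFactor 0 y := by
  have := (kernelCorr_bounds hy).1.1
  simp only [kernelFactor, if_true]
  linarith

/-- The numerator of the fourth logarithmic Euler derivative of the kernel is negative. -/
lemma kernelFactor_quartic_lt {y : ℝ} (hy : 3.14 ≤ y) :
    kernelFactor 4 y * kernelFactor 0 y ^ 3
      - (4 * kernelFactor 1 y * kernelFactor 3 y + 3 * kernelFactor 2 y ^ 2) * kernelFactor 0 y ^ 2
      + 12 * kernelFactor 1 y ^ 2 * kernelFactor 2 y * kernelFactor 0 y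
      - 6 * kernelFactor 1 y ^ 4 < y * kernelFactor 0 y ^ 4 := by
  obtain ⟨⟨l0, u0⟩, ⟨l1, u1⟩, ⟨l2, u2⟩, ⟨l3, u3⟩, ⟨l4, u4⟩⟩ := kernelCorr_bounds hy
  obtain ⟨x, rfl⟩ : ∃ x, y = 3.14 + x := ⟨y - 3.14, by ring⟩
  have hx : 0 ≤ x := by linarith
  simp only [kernelFactor, if_true, OfNat.ofNat_ne_zero, one_ne_zero, if_false]
  set e0 := kernelCorr 0 (3.14 + x)
  set e1 := kernelCorr 1 (3.14 + x)
  set e2 := kernelCorr 2 (3.14 + x)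
  set e3 := kernelCorr 3 (3.14 + x)
  set e4 := kernelCorr 4 (3.14 + x)
  clear_value e0 e1 e2 e3 e4
  obtain ⟨s, hs⟩ : ∃ s, s = 2 * (3.14 + x) - 3 := ⟨_, rfl⟩
  obtain ⟨A, hA⟩ : ∃ A, A = 2 * (3.14 + x) := ⟨_, rfl⟩
  rw [← hs, ← hA]
  have hs0 : 3 ≤ s := by linarith
  have hA0 : 6 ≤ A := by linarith
  have t1 : (A + e4) * (s + e0) ^ 3 ≤ (A + 10) * (s + 0.01) ^ 3 := by gcongr
  have hA1 : 0 ≤ A + e1 := by linarith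
  have hA3 : 0 ≤ A + e3 := by linarith
  have t2 : 4 * (A - 0.07) * (A - 2.5) * s ^ 2 ≤ 4 * (A + e1) * (A + e3) * (s + e0) ^ 2 := by
    gcongr
    all_goals linarith
  have t3 : 3 * (A - 0.01) ^ 2 * s ^ 2 ≤ 3 * (A + e2) ^ 2 * (s + e0) ^ 2 := by
    gcongr
    all_goals linarith
  have t4 : 12 * (A + e1) ^ 2 * (A + e2) * (s + e0)
      ≤ 12 * (A + 0.01) ^ 2 * (A + 0.5) * (s + 0.01) := by
    gcongr
    all_goals linarith
  have t5 : 6 * (A - 0.07) ^ 4 ≤ 6 * (A + e1) ^ 4 := by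
    gcongr
    all_goals linarith
  have t6 : (3.14 + x) * s ^ 4 ≤ (3.14 + x) * (s + e0) ^ 4 := by
    gcongr
    all_goals linarith
  have main : (A + 10) * (s + 0.01) ^ 3 - 4 * (A - 0.07) * (A - 2.5) * s ^ 2
      - 3 * (A - 0.01) ^ 2 * s ^ 2 + 12 * (A + 0.01) ^ 2 * (A + 0.5) * (s + 0.01)
      - 6 * (A - 0.07) ^ 4 < (3.14 + x) * s ^ 4 := by
    rw [hs, hA]
    nlinarith [mul_nonneg (by linarith : 0 ≤ x + 1.2) (sq_nonneg (x - 0.6)), pow_nonneg hx 2,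
      pow_nonneg hx 4, pow_nonneg hx 5]
  linarith

lemma hasDerivAt_pi_mul_exp (t : ℝ) :
    HasDerivAt (fun t => π * exp (4 * t)) (4 * (π * exp (4 * t))) t := by
  have h : HasDerivAt (fun t : ℝ => 4 * t) 4 t := by
    simpa using (hasDerivAt_id t).const_mul (4 : ℝ)
  exact (h.exp.const_mul π).congr_deriv (by ring)

lemma pi_mul_exp_pos (t : ℝ) : 0 < π * exp (4 * t) := by positivity

lemma pi_mul_exp_ge {t : ℝ} (ht : 0 ≤ t) : 3.14 ≤ π * exp (4 * t) := by
  nlinarith [pi_gt_d2, one_le_exp (by linarith : 0 ≤ 4 * t)]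

lemma Phi_eq_thetaSum (t : ℝ) :
    Phi t = exp t * (2 * ((π * exp (4 * t)) ^ 2 * thetaSum 1 0 0 2 (π * exp (4 * t)))
      - 3 * ((π * exp (4 * t)) ^ 1 * thetaSum 1 0 0 1 (π * exp (4 * t)))) := by
  have hs (j : ℕ) := summable_thetaTerm (s := 1) le_rfl (by norm_num) 0 j (pi_mul_exp_pos t)
  have h := (((((hs 2).hasSum.mul_left ((π * exp (4 * t)) ^ 2)).mul_left 2).sub
    (((hs 1).hasSum.mul_left ((π * exp (4 * t)) ^ 1)).mul_left 3)).mul_left (exp t)).tsum_eq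
  unfold thetaSum Phi
  rw [← h]
  congr 1
  ext k
  have h9 : exp (9 * t) = exp t * exp (4 * t) ^ 2 := by
    rw [← exp_nat_mul, ← exp_add]; push_cast; ring_nf
  have h5 : exp (5 * t) = exp t * exp (4 * t) := by rw [← exp_add]; ring_nf
  have hE : exp (-(((k : ℝ) + 1) ^ 2) * π * exp (4 * t))
      = exp (-((((k : ℝ) + (1 : ℕ)) ^ 2 - 0) * (π * exp (4 * t)))) := by
    push_cast; ring_nf
  simp only [thetaTerm]
  rw [h9, h5, hE]
  push_cast
  ring

lemma Phi_eq_kernelFactor (t : ℝ) :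
    Phi t = π * exp (5 * t) * exp (-(π * exp (4 * t))) * kernelFactor 0 (π * exp (4 * t)) := by
  have hy := pi_mul_exp_pos t
  have hs (l : ℕ) := summable_thetaTerm (s := 1) (a := 1) zero_le_one (by norm_num) l 0 hy
  have hone (l : ℕ) : thetaSum 2 1 l 0 (π * exp (4 * t))
      = thetaSum 1 1 l 0 (π * exp (4 * t)) - 1 := by
    rw [thetaSum_eq_add (s := 1) zero_le_one (by norm_num) l 0 hy]
    simp [thetaTerm]
  have h := ((((hs 2).hasSum.mul_left (2 * (π * exp (4 * t)))).sub
    ((hs 1).hasSum.mul_left 3)).mul_left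
      (π * exp (5 * t) * exp (-(π * exp (4 * t))))).tsum_eq
  have hf : kernelFactor 0 (π * exp (4 * t)) = 2 * (π * exp (4 * t))
      * thetaSum 1 1 2 0 (π * exp (4 * t)) - 3 * thetaSum 1 1 1 0 (π * exp (4 * t)) := by
    simp only [kernelFactor, kernelCorr, hone, if_true]
    ring
  rw [hf]
  unfold thetaSum Phi
  rw [← h]
  congr 1
  ext k
  have h9 : exp (9 * t) = exp (5 * t) * exp (4 * t) := by rw [← exp_add]; ring_nf
  have hE : exp (-(((k : ℝ) + 1) ^ 2) * π * exp (4 * t)) = exp (-(π * exp (4 * t)))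
      * exp (-((((k : ℝ) + (1 : ℕ)) ^ 2 - 1) * (π * exp (4 * t)))) := by
    rw [← exp_add]; push_cast; ring_nf
  simp only [thetaTerm]
  rw [h9, hE]
  push_cast
  ring

lemma tsum_int_exp_neg_pi_mul_sq {a : ℝ} (ha : 0 < a) :
    ∑' n : ℤ, exp (-π * a * (n : ℝ) ^ 2) = 1 + 2 * thetaSum 1 0 0 0 (π * a) := by
  have hs := summable_thetaTerm (s := 1) (a := 0) le_rfl (by norm_num) 0 0 (mul_pos pi_pos ha)
  set f : ℤ → ℝ := fun n => exp (-π * a * (n : ℝ) ^ 2) with hf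
  have e1 : (fun n : ℕ => f (-((n : ℤ) + 1))) = fun n => thetaTerm 1 0 0 0 n (π * a) := by
    ext n
    simp only [thetaTerm, hf]
    push_cast
    ring_nf
  have e2 : (fun n : ℕ => f ((n + 1 : ℕ) : ℤ)) = fun n => thetaTerm 1 0 0 0 n (π * a) := by
    ext n
    simp only [thetaTerm, hf]
    push_cast
    ring_nf
  have f0 : f ((0 : ℕ) : ℤ) = 1 := by simp [hf]
  clear_value f
  have h1 : Summable fun n : ℕ => f (-((n : ℤ) + 1)) := by rw [e1]; exact hs
  have h2 : Summable fun n : ℕ => f (n : ℤ) :=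
    (summable_nat_add_iff (f := fun n : ℕ => f (n : ℤ)) 1).1 (by rw [e2]; exact hs)
  rw [tsum_of_nat_of_neg_add_one h2 h1, h2.tsum_eq_zero_add, e1, e2, f0]
  unfold thetaSum
  ring

/-- The even function `e^t θ(e^{4t})`, with `θ` the Jacobi theta function. -/
noncomputable def thetaEven (t : ℝ) : ℝ :=
  exp t * (1 + 2 * ((π * exp (4 * t)) ^ 0 * thetaSum 1 0 0 0 (π * exp (4 * t))))

lemma thetaEven_neg (t : ℝ) : thetaEven (-t) = thetaEven t := by
  have h := Real.tsum_exp_neg_mul_int_sq (exp_pos (4 * t))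
  have h2 : -π / exp (4 * t) = -π * exp (4 * -t) := by
    rw [mul_neg, exp_neg, div_eq_mul_inv]
  rw [h2, tsum_int_exp_neg_pi_mul_sq (exp_pos _), tsum_int_exp_neg_pi_mul_sq (exp_pos _),
    ← exp_mul, one_div, ← exp_neg] at h
  simp only [thetaEven, pow_zero, one_mul]
  rw [h, ← mul_assoc, ← exp_add]
  ring_nf

lemma hasDerivAt_pow_mul_thetaSum_comp (n : ℕ) (t : ℝ) :
    HasDerivAt (fun t => (π * exp (4 * t)) ^ n * thetaSum 1 0 0 n (π * exp (4 * t)))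
      (4 * (n * ((π * exp (4 * t)) ^ n * thetaSum 1 0 0 n (π * exp (4 * t)))
        - (π * exp (4 * t)) ^ (n + 1) * thetaSum 1 0 0 (n + 1) (π * exp (4 * t)))) t := by
  have hy := (pi_mul_exp_pos t).ne'
  have h := (hasDerivAt_pow_mul_thetaSum (s := 1) le_rfl (by norm_num) n 0 n
    (pi_mul_exp_pos t)).comp t (hasDerivAt_pi_mul_exp t)
  refine h.congr_deriv ?_
  rw [← mul_assoc, mul_comm _ (4 : ℝ), mul_assoc, div_mul_cancel₀ _ hy]

/-- The derivative of `thetaEven`. -/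
noncomputable def thetaEvenDeriv (t : ℝ) : ℝ :=
  exp t * (1 + 2 * ((π * exp (4 * t)) ^ 0 * thetaSum 1 0 0 0 (π * exp (4 * t)))
    - 8 * ((π * exp (4 * t)) ^ 1 * thetaSum 1 0 0 1 (π * exp (4 * t))))

lemma hasDerivAt_thetaEven (t : ℝ) : HasDerivAt thetaEven (thetaEvenDeriv t) t := by
  have h := (Real.hasDerivAt_exp t).mul
    (((hasDerivAt_pow_mul_thetaSum_comp 0 t).const_mul 2).const_add 1)
  refine h.congr_deriv ?_
  simp only [thetaEvenDeriv]
  push_cast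
  ring

lemma hasDerivAt_thetaEvenDeriv (t : ℝ) :
    HasDerivAt thetaEvenDeriv (thetaEven t + 16 * Phi t) t := by
  have h := (Real.hasDerivAt_exp t).mul
    ((((hasDerivAt_pow_mul_thetaSum_comp 0 t).const_mul 2).const_add 1).sub
      ((hasDerivAt_pow_mul_thetaSum_comp 1 t).const_mul 8))
  refine h.congr_deriv ?_
  rw [Phi_eq_thetaSum]
  simp only [thetaEven, Pi.sub_apply]
  push_cast
  ring

lemma HasDerivAt.odd_of_even {f f' : ℝ → ℝ} (hf : ∀ t, f (-t) = f t)
    (h : ∀ t, HasDerivAt f (f' t) t) (t : ℝ) : f' (-t) = -f' t := by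
  have h1 : HasDerivAt (fun t => f (-t)) (-f' (-t)) t :=
    ((h (-t)).comp t (hasDerivAt_neg t)).congr_deriv (mul_neg_one _)
  rw [funext hf] at h1
  rw [(h t).unique h1, neg_neg]

lemma HasDerivAt.even_of_odd {f f' : ℝ → ℝ} (hf : ∀ t, f (-t) = -f t)
    (h : ∀ t, HasDerivAt f (f' t) t) (t : ℝ) : f' (-t) = f' t := by
  have h1 : HasDerivAt (fun t => f (-t)) (-f' (-t)) t :=
    ((h (-t)).comp t (hasDerivAt_neg t)).congr_deriv (mul_neg_one _)
  rw [funext hf] at h1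
  exact (neg_injective ((h t).neg.unique h1)).symm

lemma Phi_neg (t : ℝ) : Phi (-t) = Phi t := by
  have h := HasDerivAt.even_of_odd
    (HasDerivAt.odd_of_even thetaEven_neg hasDerivAt_thetaEven) hasDerivAt_thetaEvenDeriv t
  rw [thetaEven_neg] at h
  linarith

lemma kernelFactor_zero_pos (t : ℝ) : 0 < kernelFactor 0 (π * exp (4 * t)) := by
  have pos {t : ℝ} (ht : 0 ≤ t) : 0 < Phi t := by
    have := kernelFactor_zero_ge (pi_mul_exp_ge ht)
    rw [Phi_eq_kernelFactor]
    positivity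
  have h : 0 < Phi t := by
    rcases le_total 0 t with ht | ht
    · exact pos ht
    · rw [← Phi_neg]
      exact pos (neg_nonneg.2 ht)
  rw [Phi_eq_kernelFactor] at h
  exact pos_of_mul_pos_right h (by positivity)

lemma Phi_pos (t : ℝ) : 0 < Phi t := by
  have := kernelFactor_zero_pos t
  rw [Phi_eq_kernelFactor]
  positivity

lemma hasDerivAt_kernelFactor_comp {j : ℕ} (hj : j < 4) (t : ℝ) :
    HasDerivAt (fun t => kernelFactor j (π * exp (4 * t)))
      (4 * kernelFactor (j + 1) (π * exp (4 * t))) t := by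
  have hy := (pi_mul_exp_pos t).ne'
  have h := (hasDerivAt_kernelFactor hj (pi_mul_exp_pos t)).comp t (hasDerivAt_pi_mul_exp t)
  refine h.congr_deriv ?_
  rw [← mul_assoc, mul_comm _ (4 : ℝ), mul_assoc, div_mul_cancel₀ _ hy]

/-- The negative logarithmic derivative of `Φ` (for the index `0`) and its derivatives. -/
noncomputable def negLogDeriv : ℕ → ℝ → ℝ
  | 0, t => 4 * (π * exp (4 * t)) - 5
      - 4 * (kernelFactor 1 (π * exp (4 * t)) / kernelFactor 0 (π * exp (4 * t)))
  | 1, t => 16 * (π * exp (4 * t))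
      - 16 * (kernelFactor 2 (π * exp (4 * t)) / kernelFactor 0 (π * exp (4 * t))
        - kernelFactor 1 (π * exp (4 * t)) ^ 2 / kernelFactor 0 (π * exp (4 * t)) ^ 2)
  | 2, t => 64 * (π * exp (4 * t))
      - 64 * (kernelFactor 3 (π * exp (4 * t)) / kernelFactor 0 (π * exp (4 * t))
        - 3 * (kernelFactor 1 (π * exp (4 * t)) * kernelFactor 2 (π * exp (4 * t))
          / kernelFactor 0 (π * exp (4 * t)) ^ 2)
        + 2 * (kernelFactor 1 (π * exp (4 * t)) ^ 3 / kernelFactor 0 (π * exp (4 * t)) ^ 3))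
  | _, t => 256 * (π * exp (4 * t)
      - (kernelFactor 4 (π * exp (4 * t)) * kernelFactor 0 (π * exp (4 * t)) ^ 3
        - (4 * kernelFactor 1 (π * exp (4 * t)) * kernelFactor 3 (π * exp (4 * t))
          + 3 * kernelFactor 2 (π * exp (4 * t)) ^ 2) * kernelFactor 0 (π * exp (4 * t)) ^ 2
        + 12 * kernelFactor 1 (π * exp (4 * t)) ^ 2 * kernelFactor 2 (π * exp (4 * t))
          * kernelFactor 0 (π * exp (4 * t))
        - 6 * kernelFactor 1 (π * exp (4 * t)) ^ 4) / kernelFactor 0 (π * exp (4 * t)) ^ 4)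

lemma hasDerivAt_Phi (t : ℝ) : HasDerivAt Phi (-(negLogDeriv 0 t * Phi t)) t := by
  have h5 : HasDerivAt (fun t : ℝ => 5 * t) 5 t := by
    simpa using (hasDerivAt_id t).const_mul (5 : ℝ)
  have h := ((h5.exp.const_mul π).mul (hasDerivAt_pi_mul_exp t).fun_neg.exp).mul
    (hasDerivAt_kernelFactor_comp (j := 0) (by norm_num) t)
  have hfun : Phi = fun t => π * exp (5 * t) * exp (-(π * exp (4 * t)))
      * kernelFactor 0 (π * exp (4 * t)) := funext Phi_eq_kernelFactor
  have h0 := (kernelFactor_zero_pos t).ne'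
  rw [hfun]
  refine h.congr_deriv ?_
  simp only [negLogDeriv, Pi.mul_apply, zero_add]
  generalize kernelFactor 0 (π * exp (4 * t)) = S at h0
  field_simp
  ring

lemma hasDerivAt_negLogDeriv {j : ℕ} (hj : j < 3) (t : ℝ) :
    HasDerivAt (negLogDeriv j) (negLogDeriv (j + 1) t) t := by
  have hy := hasDerivAt_pi_mul_exp t
  have h0 := hasDerivAt_kernelFactor_comp (j := 0) (by norm_num) t
  have h1 := hasDerivAt_kernelFactor_comp (j := 1) (by norm_num) t
  have h2 := hasDerivAt_kernelFactor_comp (j := 2) (by norm_num) t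
  have h3 := hasDerivAt_kernelFactor_comp (j := 3) (by norm_num) t
  have hne := (kernelFactor_zero_pos t).ne'
  interval_cases j
  · refine (((hy.const_mul 4).sub_const 5).sub ((h1.fun_div h0 hne).const_mul 4)).congr_deriv ?_
    simp only [negLogDeriv]
    field_simp
    ring
  · refine ((hy.const_mul 16).sub (((h2.fun_div h0 hne).fun_sub
      ((h1.fun_pow 2).fun_div (h0.fun_pow 2) (pow_ne_zero 2 hne))).const_mul 16)).congr_deriv ?_
    simp only [negLogDeriv]
    push_cast
    field_simp
    ring
  · refine ((hy.const_mul 64).sub ((((h3.fun_div h0 hne).fun_sub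
      (((h1.fun_mul h2).fun_div (h0.fun_pow 2) (pow_ne_zero 2 hne)).const_mul 3)).fun_add
      (((h1.fun_pow 3).fun_div (h0.fun_pow 3) (pow_ne_zero 3 hne)).const_mul 2)).const_mul
        64)).congr_deriv ?_
    simp only [negLogDeriv]
    push_cast
    field_simp
    ring

lemma negLogDeriv_zero_neg (t : ℝ) : negLogDeriv 0 (-t) = -negLogDeriv 0 t := by
  have h := HasDerivAt.odd_of_even Phi_neg hasDerivAt_Phi t
  rw [Phi_neg, neg_inj, ← neg_mul] at h
  exact mul_right_cancel₀ (Phi_pos t).ne' h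

lemma negLogDeriv_two_neg (t : ℝ) : negLogDeriv 2 (-t) = -negLogDeriv 2 t :=
  HasDerivAt.odd_of_even
    (HasDerivAt.even_of_odd negLogDeriv_zero_neg (hasDerivAt_negLogDeriv (by norm_num)))
    (hasDerivAt_negLogDeriv (by norm_num)) t

lemma negLogDeriv_three_pos {t : ℝ} (ht : 0 ≤ t) : 0 < negLogDeriv 3 t := by
  have h := kernelFactor_quartic_lt (pi_mul_exp_ge ht)
  have h0 := kernelFactor_zero_pos t
  simp only [negLogDeriv]
  rw [← div_lt_iff₀ (by positivity)] at h
  linarith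

/-- A function on `[0, ∞)` vanishing at `0` with positive derivative on `(0, ∞)` is positive. -/
lemma pos_of_hasDerivAt_pos {f f' : ℝ → ℝ} (hf : ∀ t, HasDerivAt f (f' t) t)
    (hf' : ∀ t, 0 < t → 0 < f' t) (h0 : f 0 = 0) {t : ℝ} (ht : 0 < t) : 0 < f t := by
  have hmono : StrictMonoOn f (Ici 0) := by
    refine strictMonoOn_of_deriv_pos (convex_Ici 0)
      (fun x _ => (hf x).continuousAt.continuousWithinAt) fun x hx => ?_
    rw [interior_Ici] at hx
    rw [(hf x).deriv]
    exact hf' x hx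
  simpa [h0] using hmono (self_mem_Ici) ht.le ht

lemma negLogDeriv_two_pos {t : ℝ} (ht : 0 < t) : 0 < negLogDeriv 2 t := by
  refine pos_of_hasDerivAt_pos (hasDerivAt_negLogDeriv (by norm_num))
    (fun t ht => negLogDeriv_three_pos ht.le) ?_ ht
  have := negLogDeriv_two_neg 0
  rw [neg_zero] at this
  linarith

/-- The negative logarithmic derivative of `Φ` divided by `t` is strictly increasing on `(0, ∞)`:
equivalently, `log Φ(√t)` is strictly concave. -/
lemma strictMonoOn_negLogDeriv_div :
    StrictMonoOn (fun t => negLogDeriv 0 t / t) (Ioi 0) := by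
  have h0 := hasDerivAt_negLogDeriv (j := 0) (by norm_num)
  have h1 := hasDerivAt_negLogDeriv (j := 1) (by norm_num)
  have hpos {t : ℝ} (ht : 0 < t) : 0 < negLogDeriv 1 t * t - negLogDeriv 0 t := by
    refine pos_of_hasDerivAt_pos (f := fun t => negLogDeriv 1 t * t - negLogDeriv 0 t)
      (f' := fun t => negLogDeriv 2 t * t)
      (fun t => (((h1 t).mul (hasDerivAt_id t)).sub (h0 t)).congr_deriv (by simp))
      (fun t ht => mul_pos (negLogDeriv_two_pos ht) ht) ?_ ht
    have := negLogDeriv_zero_neg 0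
    rw [neg_zero] at this
    simp only [mul_zero]
    linarith
  have hd {t : ℝ} (ht : 0 < t) := (h0 t).fun_div (hasDerivAt_id t) ht.ne'
  refine strictMonoOn_of_deriv_pos (convex_Ioi 0)
    (fun t ht => (hd ht).continuousAt.continuousWithinAt) fun t ht => ?_
  rw [interior_Ioi] at ht
  have ht' : 0 < t := ht
  have := hpos ht'
  refine lt_of_lt_of_eq ?_ (hd ht').deriv.symm
  simp only [id, mul_one]
  positivity

lemma continuous_Phi : Continuous Phi :=
  continuous_iff_continuousAt.2 fun t => (hasDerivAt_Phi t).continuousAt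

lemma continuous_negLogDeriv : Continuous (negLogDeriv 0) :=
  continuous_iff_continuousAt.2 fun t =>
    (hasDerivAt_negLogDeriv (j := 0) (by norm_num) t).continuousAt

lemma pi_mul_exp_pow_le {t : ℝ} (ht : 0 ≤ t) :
    π * exp (5 * t) * exp (-(π * exp (4 * t))) * (12 * (π * exp (4 * t)) ^ 2)
      ≤ 1440 * exp (-t) := by
  have hy := pi_mul_exp_ge ht
  have hty : exp t ≤ π * exp (4 * t) := by
    have h1 : exp t ≤ exp (4 * t) := exp_le_exp.2 (by linarith)
    nlinarith [pi_gt_three, exp_pos t]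
  have h5 : π * exp (5 * t) = π * exp (4 * t) * exp t := by
    rw [mul_assoc, ← exp_add]
    ring_nf
  rw [h5]
  generalize π * exp (4 * t) = y at *
  have hy0 : 0 < y := by linarith
  have hexp := Real.pow_div_factorial_le_exp y hy0.le 5
  norm_num [Nat.factorial] at hexp
  rw [exp_neg y, exp_neg t, ← div_eq_mul_inv, ← div_eq_mul_inv, div_mul_eq_mul_div,
    div_le_div_iff₀ (exp_pos _) (exp_pos _)]
  calc y * exp t * (12 * y ^ 2) * exp t ≤ y * y * (12 * y ^ 2) * y := by gcongr
    _ = 1440 * (y ^ 5 / 120) := by ring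
    _ ≤ 1440 * exp y := by gcongr

lemma abs_Phi_le {t : ℝ} (ht : 0 ≤ t) : |Phi t| ≤ 1440 * exp (-t) := by
  have hy := pi_mul_exp_ge ht
  have hc := kernelCorr_bounds hy
  refine le_trans ?_ (pi_mul_exp_pow_le ht)
  rw [abs_of_pos (Phi_pos t), Phi_eq_kernelFactor]
  gcongr
  simp only [kernelFactor, if_true]
  nlinarith

lemma abs_negLogDeriv_mul_Phi_le {t : ℝ} (ht : 0 ≤ t) :
    |negLogDeriv 0 t * Phi t| ≤ 1440 * exp (-t) := by
  have hy := pi_mul_exp_ge ht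
  obtain ⟨⟨l0, u0⟩, ⟨l1, u1⟩, -⟩ := kernelCorr_bounds hy
  refine le_trans ?_ (pi_mul_exp_pow_le ht)
  have h0 := (kernelFactor_zero_pos t).ne'
  have h : negLogDeriv 0 t * Phi t = π * exp (5 * t) * exp (-(π * exp (4 * t)))
      * ((4 * (π * exp (4 * t)) - 5) * kernelFactor 0 (π * exp (4 * t))
        - 4 * kernelFactor 1 (π * exp (4 * t))) := by
    rw [Phi_eq_kernelFactor]
    simp only [negLogDeriv]
    generalize kernelFactor 0 (π * exp (4 * t)) = S at h0
    field_simp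
  rw [h, abs_mul, abs_of_pos (by positivity : 0 < π * exp (5 * t) * exp (-(π * exp (4 * t))))]
  gcongr
  simp only [kernelFactor, if_true, one_ne_zero, if_false]
  rw [abs_le]
  constructor <;> nlinarith

lemma integrableOn_pow_mul_of_abs_le {f : ℝ → ℝ} (hf : Continuous f) {C : ℝ}
    (hC : ∀ t, 0 ≤ t → |f t| ≤ C * exp (-t)) (n : ℕ) :
    IntegrableOn (fun t => t ^ n * f t) (Ioi 0) := by
  have hg : IntegrableOn (fun t : ℝ => C * (exp (-t) * t ^ ((n + 1 : ℝ) - 1))) (Ioi 0) :=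
    (Real.GammaIntegral_convergent (by positivity)).const_mul C
  refine Integrable.mono' hg (by fun_prop) ?_
  filter_upwards [ae_restrict_mem measurableSet_Ioi] with t ht
  have ht' : 0 < t := ht
  rw [add_sub_cancel_right, rpow_natCast, norm_mul, norm_pow, norm_of_nonneg ht'.le, norm_eq_abs]
  calc t ^ n * |f t| ≤ t ^ n * (C * exp (-t)) := by gcongr; exact hC t ht'.le
    _ = _ := by ring

lemma integrableOn_pow_mul_Phi (n : ℕ) : IntegrableOn (fun t => t ^ n * Phi t) (Ioi 0) :=
  integrableOn_pow_mul_of_abs_le continuous_Phi (fun _ => abs_Phi_le) n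

lemma integrableOn_pow_mul_negLogDeriv_mul_Phi (n : ℕ) :
    IntegrableOn (fun t => t ^ n * (negLogDeriv 0 t * Phi t)) (Ioi 0) :=
  integrableOn_pow_mul_of_abs_le (continuous_negLogDeriv.mul continuous_Phi)
    (fun _ => abs_negLogDeriv_mul_Phi_le) n

/-- Integration by parts for the moments of `Φ`. -/
lemma integral_pow_mul_negLogDeriv_mul_Phi (n : ℕ) :
    ∫ t in Ioi (0 : ℝ), t ^ (n + 1) * (negLogDeriv 0 t * Phi t)
      = (n + 1) * ∫ t in Ioi (0 : ℝ), t ^ n * Phi t := by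
  have hd (t : ℝ) : HasDerivAt (fun t => t ^ (n + 1) * Phi t)
      ((n + 1) * (t ^ n * Phi t) - t ^ (n + 1) * (negLogDeriv 0 t * Phi t)) t := by
    refine ((hasDerivAt_pow (n + 1) t).mul (hasDerivAt_Phi t)).congr_deriv ?_
    push_cast
    ring
  have hlim : Tendsto (fun t => t ^ (n + 1) * Phi t) atTop (𝓝 0) := by
    have h := (tendsto_pow_mul_exp_neg_atTop_nhds_zero (n + 1)).const_mul 1440
    rw [mul_zero] at h
    refine squeeze_zero_norm' ?_ h
    filter_upwards [eventually_ge_atTop 0] with t ht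
    rw [norm_mul, norm_pow, norm_of_nonneg ht, norm_eq_abs]
    calc t ^ (n + 1) * |Phi t| ≤ t ^ (n + 1) * (1440 * exp (-t)) := by
          gcongr
          exact abs_Phi_le ht
      _ = _ := by ring
  have hi1 := (integrableOn_pow_mul_Phi n).const_mul (n + 1 : ℝ)
  have hi2 := integrableOn_pow_mul_negLogDeriv_mul_Phi (n + 1)
  have h := integral_Ioi_of_hasDerivAt_of_tendsto (hd 0).continuousAt.continuousWithinAt
    (fun t _ => hd t) (hi1.sub hi2) hlim
  rw [integral_sub hi1 hi2, integral_const_mul] at h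
  simp only [ne_eq, Nat.add_eq_zero_iff, one_ne_zero, and_false, not_false_eq_true, zero_pow,
    zero_mul, sub_zero] at h
  linarith

lemma setIntegral_Ioi_pos {f : ℝ → ℝ} (hf : IntegrableOn f (Ioi 0)) {c : ℝ}
    (hpos : ∀ t, 0 < t → t ≠ c → 0 < f t) : 0 < ∫ t in Ioi (0 : ℝ), f t := by
  have hae : ∀ᵐ t ∂volume.restrict (Ioi (0 : ℝ)), 0 < f t := by
    filter_upwards [ae_restrict_mem measurableSet_Ioi,
      ae_restrict_of_ae (compl_mem_ae_iff.2 (measure_singleton c))] with t ht htc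
    exact hpos t ht htc
  rw [integral_pos_iff_support_of_nonneg_ae (hae.mono fun t h => h.le) hf]
  have : volume.restrict (Ioi (0 : ℝ)) (Function.support f)
      = volume.restrict (Ioi (0 : ℝ)) univ :=
    measure_congr (eventuallyEq_univ.2 (hae.mono fun t h => h.ne'))
  rw [this]
  simp

lemma turanMoment_pos (m : ℕ) : 0 < turanMoment m :=
  setIntegral_Ioi_pos (c := 0) (integrableOn_pow_mul_Phi _)
    fun t ht _ => mul_pos (pow_pos ht _) (Phi_pos t)

lemma turanMoment_ineq (k : ℕ) :
    (2 * k + 1) * turanMoment k * turanMoment (k + 2)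
      < (2 * k + 3) * turanMoment (k + 1) ^ 2 := by
  have hB := turanMoment_pos (k + 1)
  have hC := turanMoment_pos (k + 2)
  obtain ⟨c, hc, hcC⟩ : ∃ c, 0 < c ∧ c ^ 2 * turanMoment (k + 1) = turanMoment (k + 2) := by
    refine ⟨√(turanMoment (k + 2) / turanMoment (k + 1)), sqrt_pos.2 (by positivity), ?_⟩
    rw [sq_sqrt (by positivity), div_mul_cancel₀ _ hB.ne']
  set G := negLogDeriv 0 c / c with hG
  have i1 := integrableOn_pow_mul_negLogDeriv_mul_Phi (2 * k + 2 + 1)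
  have i2 := (integrableOn_pow_mul_negLogDeriv_mul_Phi (2 * k + 1)).const_mul (c ^ 2)
  have i3 := (integrableOn_pow_mul_Phi (2 * (k + 2))).const_mul G
  have i4 := (integrableOn_pow_mul_Phi (2 * (k + 1))).const_mul (G * c ^ 2)
  have hpos := setIntegral_Ioi_pos (c := c) (((i1.sub i2).sub i3).add i4) (fun t ht htc => by
    have hmono := strictMonoOn_negLogDeriv_div
    have hprod : 0 < (t ^ 2 - c ^ 2) * (negLogDeriv 0 t / t - G) := by
      rcases lt_or_gt_of_ne htc with h | h
      · exact mul_pos_of_neg_of_neg (by nlinarith) (sub_neg.2 (hmono ht hc h))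
      · exact mul_pos (by nlinarith) (sub_pos.2 (hmono hc ht h))
    have hfac : 0 < t ^ (2 * k + 2) * Phi t := mul_pos (pow_pos ht _) (Phi_pos t)
    refine lt_of_lt_of_eq (mul_pos hfac hprod) ?_
    simp only [Pi.add_apply, Pi.sub_apply]
    field_simp
    ring)
  rw [integral_add' ((i1.sub i2).sub i3) i4, integral_sub' (i1.sub i2) i3, integral_sub' i1 i2,
    integral_const_mul, integral_const_mul, integral_const_mul,
    integral_pow_mul_negLogDeriv_mul_Phi, integral_pow_mul_negLogDeriv_mul_Phi] at hpos
  change 0 < ((2 * k + 2 : ℕ) + 1) * turanMoment (k + 1)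
    - c ^ 2 * (((2 * k : ℕ) + 1) * turanMoment k) - G * turanMoment (k + 2)
    + G * c ^ 2 * turanMoment (k + 1) at hpos
  push_cast at hpos
  rw [mul_assoc G, hcC, sub_add_cancel] at hpos
  rw [← hcC]
  linarith [mul_pos hpos hB]

theorem turan_inequalities (m : ℕ) (hm : 1 ≤ m) :
    (turanMoment m) ^ 2 >
      ((2 * (m : ℝ) - 1) / (2 * (m : ℝ) + 1)) * turanMoment (m - 1) * turanMoment (m + 1) := by
  obtain ⟨k, rfl⟩ : ∃ k, m = k + 1 := ⟨m - 1, by omega⟩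
  have h := turanMoment_ineq k
  rw [Nat.add_sub_cancel, gt_iff_lt, mul_assoc, div_mul_eq_mul_div, div_lt_iff₀ (by positivity)]
  push_cast
  linarith
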